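/- Let H be a finite-dimensional Hopf algebra. The map Ψ₁: H* ⊗ H → End(H) defined by Ψ₁(α ⊗ h)(t) = α ⇁' (ht), where α ⇁' u = ⟨α, S⁻¹(u₁)⟩ u₂, is an algebra isomorphism from the Heisenberg double H(H*) (with multiplication (α ⊗ h)(α' ⊗ h') = α(h₁ ⇀ α') ⊗ h₂h') onto End(H). -/

import Mathlib

open TensorProduct

/-- Convolution product on `H* = Dual k H`. -/
noncomputable def conv {k H : Type*} [CommSemiring k] [Semiring H] [HopfAlgebra k H]
    (α β : Module.Dual k H) : Module.Dual k H :=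
  (LinearMap.mul' k k) ∘ₗ (TensorProduct.map α β) ∘ₗ (Coalgebra.comul (R := k))

/-- The action `⇀` of `H` on `H*`: `⟨h ⇀ β, x⟩ = ⟨β, x h⟩`. -/
noncomputable def hR {k H : Type*} [CommSemiring k] [Semiring H] [Algebra k H]
    (h : H) (β : Module.Dual k H) : Module.Dual k H :=
  β ∘ₗ LinearMap.mulRight k h

/-- The action `⇁'` of `H*` on `H`: `α ⇁' u = ⟨α, S⁻¹(u₁)⟩ u₂`. -/
noncomputable def lAct' {k H : Type*} [CommSemiring k] [Semiring H] [HopfAlgebra k H]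
    (Sinv : H →ₗ[k] H) (α : Module.Dual k H) : H →ₗ[k] H :=
  (TensorProduct.lid k H).toLinearMap ∘ₗ
    (TensorProduct.map (α ∘ₗ Sinv) LinearMap.id) ∘ₗ (Coalgebra.comul (R := k))

section Helpers
open Coalgebra HopfAlgebra

variable {k H : Type*} [Field k] [Ring H] [HopfAlgebra k H]

lemma aux_lAct' (Sinv : H →ₗ[k] H) (α : Module.Dual k H) (u : H) {ι : Type*} (r : Repr k u ι) :
    lAct' Sinv α u = ∑ i ∈ r.index, α (Sinv (r.left i)) • r.right i := by
  simp [lAct', ← r.eq, map_sum]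

lemma aux_conv (α β : Module.Dual k H) (u : H) {ι : Type*} (r : Repr k u ι) :
    conv α β u = ∑ i ∈ r.index, α (r.left i) * β (r.right i) := by
  simp [conv, ← r.eq, map_sum]

lemma aux_coassoc {M : Type*} [AddCommMonoid M] [Module k M] (T : H ⊗[k] (H ⊗[k] H) →ₗ[k] M)
    (h : H) {ι : Type*} (r : Repr k h ι) :
    ∑ i ∈ r.index, ∑ j ∈ (ℛ k (r.left i)).index,
      T ((ℛ k (r.left i)).left j ⊗ₜ[k] ((ℛ k (r.left i)).right j ⊗ₜ[k] r.right i)) =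
    ∑ i ∈ r.index, ∑ j ∈ (ℛ k (r.right i)).index,
      T (r.left i ⊗ₜ[k] ((ℛ k (r.right i)).left j ⊗ₜ[k] (ℛ k (r.right i)).right j)) := by
  have := congrArg T (sum_tmul_tmul_eq r (fun i => ℛ k (r.left i)) (fun i => ℛ k (r.right i)))
  simpa only [map_sum] using this

lemma aux_sinv_mul (Sinv : H →ₗ[k] H)
    (hS1 : ∀ x, Sinv (antipode k x) = x) (hS2 : ∀ x, antipode k (Sinv x) = x)
    (a b : H) : Sinv (a * b) = Sinv b * Sinv a := by
  rw [← hS1 (Sinv b * Sinv a), antipode_mul_antidistrib, hS2, hS2]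

lemma aux_eps (Sinv : H →ₗ[k] H)
    (hS1 : ∀ x, Sinv (antipode k x) = x) (hS2 : ∀ x, antipode k (Sinv x) = x)
    (h : H) {ι : Type*} (r : Repr k h ι) :
    ∑ i ∈ r.index, Sinv (r.right i) * r.left i = counit (R := k) h • 1 := by
  rw [← hS1 (∑ i ∈ r.index, Sinv (r.right i) * r.left i), map_sum]
  simp_rw [antipode_mul_antidistrib, hS2]
  rw [sum_antipode_mul_eq_smul, map_smul]
  congr 1
  simpa using hS1 1

lemma aux_L1 (Sinv : H →ₗ[k] H)
    (hS1 : ∀ x, Sinv (antipode k x) = x) (hS2 : ∀ x, antipode k (Sinv x) = x)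
    (h : H) {ι : Type*} (r : Repr k h ι) :
    ∑ i ∈ r.index, ∑ j ∈ (ℛ k (r.right i)).index,
      (Sinv ((ℛ k (r.right i)).left j) * r.left i) ⊗ₜ[k] (ℛ k (r.right i)).right j
      = (1 : H) ⊗ₜ[k] h := by
  have := aux_coassoc (k := k) ((LinearMap.rTensor H (LinearMap.mul' k H ∘ₗ
    (TensorProduct.comm k H H).toLinearMap ∘ₗ LinearMap.lTensor H Sinv)) ∘ₗ
    (TensorProduct.assoc k H H H).symm.toLinearMap) h r
  simp only [LinearMap.comp_apply, LinearEquiv.coe_coe, TensorProduct.assoc_symm_tmul,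
    LinearMap.rTensor_tmul, LinearMap.lTensor_tmul, TensorProduct.comm_tmul,
    LinearMap.mul'_apply] at this
  rw [← this]
  simp_rw [← TensorProduct.sum_tmul, aux_eps Sinv hS1 hS2, TensorProduct.smul_tmul,
    ← TensorProduct.tmul_sum, sum_counit_smul]

lemma aux_comul_antipode (x : H) : comul (R := k) (antipode k x) =
    TensorProduct.map (antipode k) (antipode k) (TensorProduct.comm k H H (comul x)) := by
  have key : WithConv.toConv ((TensorProduct.map (antipode k) (antipode k)) ∘ₗ
      (TensorProduct.comm k H H).toLinearMap ∘ₗ (comul (R := k) (A := H))) =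
      WithConv.toConv (comul (R := k) ∘ₗ antipode k) := by
    refine left_inv_eq_right_inv ?_ LinearMap.comul_right_inv
    ext c
    rw [(ℛ k c).convMul_apply]
    have h1 := aux_coassoc (k := k) (LinearMap.mul' k (H ⊗[k] H) ∘ₗ
      TensorProduct.map (TensorProduct.map (antipode k) (antipode k) ∘ₗ
        (TensorProduct.comm k H H).toLinearMap) (comul (R := k)) ∘ₗ
      (TensorProduct.assoc k H H H).symm.toLinearMap) c (ℛ k c)
    simp only [LinearMap.comp_apply, LinearEquiv.coe_coe, TensorProduct.assoc_symm_tmul,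
      TensorProduct.map_tmul, TensorProduct.comm_tmul, LinearMap.mul'_apply] at h1
    have e : ∀ x : H, TensorProduct.map (antipode k) (antipode k)
        (TensorProduct.comm k H H (comul (R := k) x)) = ∑ j ∈ (ℛ k x).index,
        antipode k ((ℛ k x).right j) ⊗ₜ[k] antipode k ((ℛ k x).left j) := by
      intro x
      rw [← (ℛ k x).eq]
      simp only [map_sum, TensorProduct.comm_tmul, TensorProduct.map_tmul]
    have h2 : ∀ x : H, ∑ j ∈ (ℛ k x).index, (antipode k ((ℛ k x).left j) ⊗ₜ[k] (1 : H)) *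
        comul (R := k) ((ℛ k x).right j) = (1 : H) ⊗ₜ[k] x := by
      intro x
      have h3 := aux_coassoc (k := k) (LinearMap.rTensor H (LinearMap.mul' k H ∘ₗ
        LinearMap.rTensor H (antipode k)) ∘ₗ
        (TensorProduct.assoc k H H H).symm.toLinearMap) x (ℛ k x)
      simp only [LinearMap.comp_apply, LinearEquiv.coe_coe, TensorProduct.assoc_symm_tmul,
        LinearMap.rTensor_tmul, LinearMap.mul'_apply] at h3
      have e2 : ∀ a y : H, (antipode k a ⊗ₜ[k] (1 : H)) * comul (R := k) y =
          ∑ j ∈ (ℛ k y).index, (antipode k a * (ℛ k y).left j) ⊗ₜ[k] (ℛ k y).right j := by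
        intro a y
        conv_lhs => rw [← (ℛ k y).eq]
        simp only [Finset.mul_sum, Algebra.TensorProduct.tmul_mul_tmul, one_mul]
      simp_rw [e2]
      rw [← h3]
      simp_rw [← TensorProduct.sum_tmul, sum_antipode_mul_eq_smul, TensorProduct.smul_tmul,
        ← TensorProduct.tmul_sum, sum_counit_smul]
    have e3 : ∀ a b y : H, (antipode k b ⊗ₜ[k] antipode k a) * comul (R := k) y =
        ((1 : H) ⊗ₜ[k] antipode k a) * ((antipode k b ⊗ₜ[k] (1 : H)) * comul (R := k) y) := by
      intro a b y
      rw [← mul_assoc, Algebra.TensorProduct.tmul_mul_tmul, one_mul, mul_one]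
    simp only [LinearMap.comp_apply, LinearEquiv.coe_coe, e, Finset.sum_mul]
    rw [h1]
    simp_rw [e3, ← Finset.mul_sum, h2, Algebra.TensorProduct.tmul_mul_tmul, one_mul,
      ← TensorProduct.tmul_sum, sum_antipode_mul_eq_smul]
    simp [Algebra.TensorProduct.one_def, Algebra.algebraMap_eq_smul_one]
  exact (congrArg (fun f => f.ofConv x) key).symm

lemma aux_comul_sinv (Sinv : H →ₗ[k] H)
    (hS1 : ∀ x, Sinv (antipode k x) = x) (hS2 : ∀ x, antipode k (Sinv x) = x)
    (x : H) : comul (R := k) (Sinv x) =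
    TensorProduct.map Sinv Sinv (TensorProduct.comm k H H (comul x)) := by
  have h := aux_comul_antipode (k := k) (Sinv x)
  rw [hS2] at h
  rw [h, ← LinearMap.comp_apply, ← LinearEquiv.coe_coe, ← LinearMap.comp_apply]
  have : (TensorProduct.map Sinv Sinv ∘ₗ (TensorProduct.comm k H H).toLinearMap) ∘ₗ
     (TensorProduct.map (antipode k) (antipode k) ∘ₗ (TensorProduct.comm k H H).toLinearMap)
     = LinearMap.id := by
    ext a b; simp [hS1]
  exact (LinearMap.congr_fun this _).symm

lemma aux_L2 (Sinv : H →ₗ[k] H)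
    (hS1 : ∀ x, Sinv (antipode k x) = x) (hS2 : ∀ x, antipode k (Sinv x) = x)
    (α β : Module.Dual k H) (u : H) :
    lAct' Sinv (conv α β) u = lAct' Sinv α (lAct' Sinv β u) := by
  rw [aux_lAct' Sinv _ u (ℛ k u), aux_lAct' Sinv β u (ℛ k u), map_sum]
  have e : ∀ x, conv α β (Sinv x) =
      ∑ j ∈ (ℛ k x).index, α (Sinv ((ℛ k x).right j)) * β (Sinv ((ℛ k x).left j)) := by
    intro x
    rw [conv, LinearMap.comp_apply, LinearMap.comp_apply, aux_comul_sinv Sinv hS1 hS2,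
      ← (ℛ k x).eq]
    simp [map_sum]
  have := aux_coassoc (k := k) ((TensorProduct.lid k H).toLinearMap ∘ₗ
    TensorProduct.map (β ∘ₗ Sinv) ((TensorProduct.lid k H).toLinearMap ∘ₗ
    LinearMap.rTensor H (α ∘ₗ Sinv))) u (ℛ k u)
  simp only [LinearMap.comp_apply, LinearEquiv.coe_coe, TensorProduct.map_tmul,
    LinearMap.rTensor_tmul, TensorProduct.lid_tmul] at this
  simp only [map_smul]
  simp only [aux_lAct' Sinv α _ (ℛ k _), e, Finset.sum_smul, Finset.smul_sum]
  rw [← this]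
  refine Finset.sum_congr rfl fun i _ => Finset.sum_congr rfl fun j _ => ?_
  rw [smul_smul, mul_comm]

lemma aux_L3 (Sinv : H →ₗ[k] H)
    (hS1 : ∀ x, Sinv (antipode k x) = x) (hS2 : ∀ x, antipode k (Sinv x) = x)
    (α : Module.Dual k H) (h u : H) {ι : Type*} (r : Repr k h ι) :
    ∑ i ∈ r.index, lAct' Sinv (hR (r.left i) α) (r.right i * u) = h * lAct' Sinv α u := by
  have e : ∀ a b : H, lAct' Sinv (hR a α) (b * u) = ∑ p ∈ (ℛ k u).index,
      ∑ j ∈ (ℛ k b).index, α (Sinv ((ℛ k u).left p) * (Sinv ((ℛ k b).left j) * a)) •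
        ((ℛ k b).right j * (ℛ k u).right p) := by
    intro a b
    rw [lAct', LinearMap.comp_apply, LinearMap.comp_apply, Bialgebra.comul_mul,
      ← (ℛ k b).eq, ← (ℛ k u).eq, Finset.sum_mul_sum, Finset.sum_comm]
    simp [map_sum, hR, aux_sinv_mul Sinv hS1 hS2, mul_assoc]
  simp_rw [e]
  rw [Finset.sum_comm, aux_lAct' Sinv α u (ℛ k u), Finset.mul_sum]
  refine Finset.sum_congr rfl fun p _ => ?_
  have := congrArg ((TensorProduct.lid k H).toLinearMap ∘ₗ
    TensorProduct.map (α ∘ₗ LinearMap.mulLeft k (Sinv ((ℛ k u).left p)))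
      (LinearMap.mulRight k ((ℛ k u).right p))) (aux_L1 Sinv hS1 hS2 h r)
  simpa [map_sum] using this

lemma aux_surj [FiniteDimensional k H] (Sinv : H →ₗ[k] H)
    (hS2 : ∀ x, antipode k (Sinv x) = x) (g : H →ₗ[k] H) :
    g ∈ Submodule.span k {f : H →ₗ[k] H | ∃ (α : Module.Dual k H) (x : H),
      f = LinearMap.mulLeft k x ∘ₗ lAct' Sinv α} := by
  let b := Module.finBasis k H
  let f' : H →ₗ[k] H := LinearMap.mul' k H ∘ₗ TensorProduct.map g (antipode k) ∘ₗ comul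
  have hf' : ∀ t, ∑ i ∈ (ℛ k t).index, f' ((ℛ k t).left i) * (ℛ k t).right i = g t := by
    intro t
    have := aux_coassoc (k := k) (LinearMap.mul' k H ∘ₗ TensorProduct.map g
      (LinearMap.mul' k H ∘ₗ LinearMap.rTensor H (antipode k))) t (ℛ k t)
    simp only [LinearMap.comp_apply, TensorProduct.map_tmul, LinearMap.rTensor_tmul,
      LinearMap.mul'_apply] at this
    have e : ∀ x, f' x = ∑ j ∈ (ℛ k x).index,
        g ((ℛ k x).left j) * antipode k ((ℛ k x).right j) := by
      intro x
      simp only [f', LinearMap.comp_apply]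
      rw [← (ℛ k x).eq]
      simp [map_sum]
    simp_rw [e, Finset.sum_mul, mul_assoc]
    rw [this]
    simp_rw [← Finset.mul_sum, sum_antipode_mul_eq_smul, mul_smul_comm, mul_one, ← map_smul,
      ← map_sum]
    congr 1
    have := congrArg (TensorProduct.rid k H) (sum_tmul_counit_eq (ℛ k t))
    simpa only [map_sum, TensorProduct.rid_tmul, one_smul] using this
  have : g = ∑ j, LinearMap.mulLeft k (b j) ∘ₗ
      lAct' Sinv ((b.coord j) ∘ₗ f' ∘ₗ antipode k) := by
    ext t
    rw [← hf' t, LinearMap.sum_apply]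
    simp only [LinearMap.comp_apply, LinearMap.mulLeft_apply, aux_lAct' Sinv _ t (ℛ k t), hS2,
      Finset.mul_sum]
    rw [Finset.sum_comm]
    refine Finset.sum_congr rfl fun i _ => ?_
    have hb := congrArg (· * (ℛ k t).right i) (b.sum_repr (f' ((ℛ k t).left i)))
    simp only [Finset.sum_mul, smul_mul_assoc] at hb
    simpa using hb.symm
  rw [this]
  exact Submodule.sum_mem _ fun j _ => Submodule.subset_span ⟨_, _, rfl⟩

end Helpers

/-- `Ψ₁ : H(H*) → End(H)`, `Ψ₁(α ⊗ h)(t) = α ⇁' (ht)`, is an algebra isomorphism from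
the Heisenberg double onto `End(H)`. -/
theorem stmt6 {k H : Type*} [Field k] [Ring H] [HopfAlgebra k H] [FiniteDimensional k H]
    (Sinv : H →ₗ[k] H)
    (hS1 : ∀ x, Sinv ((HopfAlgebra.antipode (R := k) : H →ₗ[k] H) x) = x)
    (hS2 : ∀ x, (HopfAlgebra.antipode (R := k) : H →ₗ[k] H) (Sinv x) = x)
    (Ψ : Module.Dual k H ⊗[k] H →ₗ[k] (H →ₗ[k] H))
    (hΨ : ∀ (α : Module.Dual k H) (h t : H), Ψ (α ⊗ₜ[k] h) t = lAct' Sinv α (h * t)) :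
    Function.Bijective Ψ ∧
    (∀ (α α' : Module.Dual k H) (h h' : H) (ι : Type) [Fintype ι] (h1 h2 : ι → H),
      Coalgebra.comul (R := k) h = ∑ i, h1 i ⊗ₜ[k] h2 i →
        Ψ (∑ i, (conv α (hR (h1 i) α')) ⊗ₜ[k] (h2 i * h'))
          = Ψ (α ⊗ₜ[k] h) ∘ₗ Ψ (α' ⊗ₜ[k] h')) ∧
    Ψ ((Coalgebra.counit (R := k) : Module.Dual k H) ⊗ₜ[k] (1 : H)) = LinearMap.id := by
  refine ⟨?_, ?_, ?_⟩
  · have hs : Function.Surjective Ψ := by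
      rw [← LinearMap.range_eq_top, eq_top_iff]
      intro g _
      refine Submodule.span_le.2 ?_ (aux_surj Sinv hS2 g)
      rintro _ ⟨α, x, rfl⟩
      refine ⟨∑ i ∈ (Coalgebra.Repr.arbitrary k x).index,
        (hR ((Coalgebra.Repr.arbitrary k x).left i) α) ⊗ₜ[k]
          ((Coalgebra.Repr.arbitrary k x).right i), ?_⟩
      ext t
      simp only [map_sum, LinearMap.sum_apply, hΨ, LinearMap.comp_apply, LinearMap.mulLeft_apply]
      exact aux_L3 Sinv hS1 hS2 α x t _
    have hfr : Module.finrank k (Module.Dual k H ⊗[k] H) = Module.finrank k (H →ₗ[k] H) := by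
      simp [Module.finrank_tensorProduct, Module.finrank_linearMap, Subspace.dual_finrank_eq]
    have hi := (LinearMap.injective_iff_surjective_of_finrank_eq_finrank
      (K := k) (V := Module.Dual k H ⊗[k] H) (V₂ := H →ₗ[k] H) (f := Ψ) hfr).2 hs
    exact ⟨hi, hs⟩
  · intro α α' h h' ι _ h1 h2 hh
    ext t
    simp only [map_sum, LinearMap.sum_apply, hΨ, LinearMap.comp_apply]
    simp_rw [aux_L2 Sinv hS1 hS2, mul_assoc]
    rw [← map_sum]
    congr 1
    exact aux_L3 Sinv hS1 hS2 α' h (h' * t) ⟨Finset.univ, h1, h2, hh.symm⟩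
  · ext t
    rw [hΨ, one_mul, aux_lAct' Sinv _ t (Coalgebra.Repr.arbitrary k t)]
    have e : ∀ x, Coalgebra.counit (R := k) (Sinv x) = Coalgebra.counit (R := k) x := by
      intro x
      rw [← HopfAlgebra.counit_antipode (R := k) (Sinv x), hS2]
    simp_rw [e]
    exact Coalgebra.sum_counit_smul _
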